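/- Let D > 0. If two joint distributions P_{XY} and Q_{XY} both minimize the rate-distortion function R(D), then their induced conditional distributions of X given Y coincide: P_{X|Y} = Q_{X|Y}. -/

import Mathlib

open scoped BigOperators ENNReal Classical
open Filter

section InformationDefs

variable {α X Y : Type*}

/-- A probability mass function on a finite alphabet. -/
def IsPMF [Fintype α] (P : α → ℝ) : Prop :=
  (∀ a, 0 ≤ P a) ∧ ∑ a, P a = 1

/-- Variational distance `‖P − Q‖ = sup_A |P(A) − Q(A)|` on a finite alphabet. -/
noncomputable def tvDist [Fintype α] (P Q : α → ℝ) : ℝ :=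
  Finset.univ.powerset.sup' ⟨∅, Finset.empty_mem_powerset _⟩
    fun A => |∑ a ∈ A, P a - ∑ a ∈ A, Q a|

/-- Relative entropy `D(P‖Q) = ∑ P log(P/Q)` on a finite alphabet, infinite when
`P` is not absolutely continuous with respect to `Q`. -/
noncomputable def relEnt [Fintype α] (P Q : α → ℝ) : ℝ≥0∞ :=
  if ∀ a, Q a = 0 → P a = 0 then
    ENNReal.ofReal (∑ a, P a * Real.log (P a / Q a))
  else ⊤

/-- Shannon entropy on a finite alphabet. -/
noncomputable def entropy [Fintype α] (P : α → ℝ) : ℝ :=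
  -∑ a, P a * Real.log (P a)

/-- First (X-) marginal of a joint distribution. -/
noncomputable def margX [Fintype Y] (P : X × Y → ℝ) : X → ℝ :=
  fun x => ∑ y, P (x, y)

/-- Second (Y-) marginal of a joint distribution. -/
noncomputable def margY [Fintype X] (P : X × Y → ℝ) : Y → ℝ :=
  fun y => ∑ x, P (x, y)

/-- Backward conditional distribution `P_{X|Y}(x|y) = P(x,y)/P_Y(y)`. -/
noncomputable def condXY [Fintype X] (P : X × Y → ℝ) : X → Y → ℝ :=
  fun x y => P (x, y) / margY P y

/-- Forward conditional distribution `P_{Y|X}(y|x) = P(x,y)/P_X(x)`. -/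
noncomputable def condYX [Fintype Y] (P : X × Y → ℝ) : Y → X → ℝ :=
  fun y x => P (x, y) / margX P x

/-- Mutual information `I(X;Y)` of a joint distribution on a finite product alphabet. -/
noncomputable def mutualInfo [Fintype X] [Fintype Y] (P : X × Y → ℝ) : ℝ :=
  ∑ x, ∑ y, P (x, y) * Real.log (P (x, y) / (margX P x * margY P y))

/-- A block code of length `n`: an encoder into `{1,…,M}` and a decoder. -/
structure Code (X Y : Type*) (n : ℕ) where
  M : ℕ
  hM : 0 < M
  enc : (Fin n → X) → Fin M
  dec : Fin M → Fin n → Y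

/-- Rate `R_n = (1/n) log M` of a code. -/
noncomputable def Code.rate {X Y : Type*} {n : ℕ} (c : Code X Y n) : ℝ :=
  Real.log c.M / n

/-- The reconstruction sequence `Yⁿ = g_n(f_n(xⁿ))` produced by a code. -/
def Code.out {X Y : Type*} {n : ℕ} (c : Code X Y n) (xs : Fin n → X) : Fin n → Y :=
  c.dec (c.enc xs)

/-- The i.i.d. (memoryless) source distribution on `n`-blocks. -/
noncomputable def iid (PX : X → ℝ) (n : ℕ) : (Fin n → X) → ℝ :=
  fun xs => ∏ i, PX (xs i)

/-- The code-induced joint distribution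
`P_{XⁿYⁿ}(xⁿ,yⁿ) = ∏ P_X(x_i) · 1{yⁿ = g_n(f_n(xⁿ))}`. -/
noncomputable def inducedJoint [DecidableEq Y] (PX : X → ℝ) {n : ℕ} (c : Code X Y n) :
    (Fin n → X) × (Fin n → Y) → ℝ :=
  fun p => (∏ i, PX (p.1 i)) * (if p.2 = c.out p.1 then 1 else 0)

/-- The approximating joint distribution
`Q_{XⁿYⁿ}(xⁿ,yⁿ) = (|g_n⁻¹(yⁿ)|/M) · ∏ P_{X|Y}(x_i|y_i)`:
a uniformly chosen codeword passed through the backward memoryless channel. -/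
noncomputable def approxJoint [Fintype X] [DecidableEq Y] (PXY : X × Y → ℝ) {n : ℕ}
    (c : Code X Y n) : (Fin n → X) × (Fin n → Y) → ℝ :=
  fun p => (((Finset.univ.filter fun m => c.dec m = p.2).card : ℝ) / c.M) *
    ∏ i, condXY PXY (p.1 i) (p.2 i)

/-- The uniform distribution over the codebook, `Q_{Yⁿ}(yⁿ) = |g_n⁻¹(yⁿ)|/M`. -/
noncomputable def codebookUniform [DecidableEq Y] {n : ℕ} (c : Code X Y n) :
    (Fin n → Y) → ℝ :=
  fun ys => ((Finset.univ.filter fun m => c.dec m = ys).card : ℝ) / c.M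

/-- The empirical (joint type) distribution of a pair of sequences. -/
noncomputable def empDist [DecidableEq X] [DecidableEq Y] {n : ℕ}
    (xs : Fin n → X) (ys : Fin n → Y) : X × Y → ℝ :=
  fun p => ((Finset.univ.filter fun i => xs i = p.1 ∧ ys i = p.2).card : ℝ) / n

/-- `‖T_{XⁿYⁿ} − P_{XY}‖ → 0` in probability under the i.i.d. source. -/
def TVInProb [Fintype X] [Fintype Y] [DecidableEq X] [DecidableEq Y]
    (PX : X → ℝ) (PXY : X × Y → ℝ) (c : ∀ n, Code X Y n) : Prop :=
  ∀ ε : ℝ, 0 < ε →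
    Tendsto (fun n => ∑ xs : Fin n → X,
        if ε < tvDist (empDist xs ((c n).out xs)) PXY then iid PX n xs else 0)
      atTop (nhds 0)

/-- A good sequence of coordination codes for `P_{Y|X}` (specified via the joint `PXY`):
the rates converge to `I(X;Y)` and the empirical distribution converges to `PXY`
in variational distance, in probability. -/
def GoodCoord [Fintype X] [Fintype Y] [DecidableEq X] [DecidableEq Y]
    (PX : X → ℝ) (PXY : X × Y → ℝ) (c : ∀ n, Code X Y n) : Prop :=
  Tendsto (fun n => (c n).rate) atTop (nhds (mutualInfo PXY)) ∧ TVInProb PX PXY c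

end InformationDefs
section RateDistortionDefs

variable {X Y : Type*}

/-- Expected per-letter distortion `E d(X,Y)` of a joint distribution. -/
noncomputable def expDist [Fintype X] [Fintype Y] (P : X × Y → ℝ) (d : X → Y → ℝ) : ℝ :=
  ∑ x, ∑ y, P (x, y) * d x y

/-- The rate-distortion function `R(D) = min I(X;Y)` over joint distributions with
`X`-marginal `PX` and expected distortion at most `D`. -/
noncomputable def RD [Fintype X] [Fintype Y] (PX : X → ℝ) (d : X → Y → ℝ) (D : ℝ) : ℝ :=
  sInf {r | ∃ P : X × Y → ℝ,
    IsPMF P ∧ margX P = PX ∧ expDist P d ≤ D ∧ r = mutualInfo P}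

/-- `P` is a minimizer of the rate-distortion function at distortion level `D`. -/
def IsRDMinimizer [Fintype X] [Fintype Y] (PX : X → ℝ) (d : X → Y → ℝ) (D : ℝ)
    (P : X × Y → ℝ) : Prop :=
  IsPMF P ∧ margX P = PX ∧ expDist P d ≤ D ∧ mutualInfo P = RD PX d D

/-- Average per-letter expected distortion `(1/n) ∑ᵢ E d(Xᵢ,Yᵢ)` of a code on the
i.i.d. source. -/
noncomputable def codeDist [Fintype X] (PX : X → ℝ) (d : X → Y → ℝ) {n : ℕ}
    (c : Code X Y n) : ℝ :=
  ∑ xs : Fin n → X, iid PX n xs * ((1 / n : ℝ) * ∑ i, d (xs i) (c.out xs i))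

/-- A good (i.e. `R(D)`-achieving) sequence of rate-distortion codes for distortion `D`. -/
def GoodRD [Fintype X] [Fintype Y] (PX : X → ℝ) (d : X → Y → ℝ) (D : ℝ)
    (c : ∀ n, Code X Y n) : Prop :=
  Tendsto (fun n => (c n).rate) atTop (nhds (RD PX d D)) ∧
  limsup (fun n => codeDist PX d (c n)) atTop ≤ D

end RateDistortionDefs
/-- The two-term log-sum inequality, in strict form. -/
theorem mul_log_half_add_lt {a b c s t : ℝ} (ha : 0 ≤ a) (hb : 0 ≤ b) (hc : 0 < c)
    (hs : 0 < s) (ht : 0 < t) (hne : a / s ≠ b / t) :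
    (a + b) / 2 * Real.log ((a + b) / 2 / (c * ((s + t) / 2))) <
      (a * Real.log (a / (c * s)) + b * Real.log (b / (c * t))) / 2 := by
  have hne' : a / (c * s) ≠ b / (c * t) := by
    intro h
    apply hne
    field_simp at h ⊢
    linarith
  have hconv := Real.strictConvexOn_mul_log.2
    (show a / (c * s) ∈ Set.Ici (0 : ℝ) from Set.mem_Ici.2 (by positivity))
    (show b / (c * t) ∈ Set.Ici (0 : ℝ) from Set.mem_Ici.2 (by positivity)) hne'
    (show 0 < s / (s + t) by positivity) (show 0 < t / (s + t) by positivity)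
    (by field_simp)
  simp only [smul_eq_mul] at hconv
  have harg : s / (s + t) * (a / (c * s)) + t / (s + t) * (b / (c * t)) =
      (a + b) / 2 / (c * ((s + t) / 2)) := by
    field_simp
  rw [harg] at hconv
  have hmul := mul_lt_mul_of_pos_left hconv (show 0 < c * ((s + t) / 2) by positivity)
  generalize Real.log ((a + b) / 2 / (c * ((s + t) / 2))) = w at hmul ⊢
  generalize Real.log (a / (c * s)) = u at hmul ⊢
  generalize Real.log (b / (c * t)) = v at hmul ⊢
  calc (a + b) / 2 * w = c * ((s + t) / 2) * ((a + b) / 2 / (c * ((s + t) / 2)) * w) := by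
        field_simp
    _ < _ := hmul
    _ = (a * u + b * v) / 2 := by field_simp

/-- The two-term log-sum inequality, in non-strict form. -/
theorem mul_log_half_add_le {a b c s t : ℝ} (ha : 0 ≤ a) (hb : 0 ≤ b) (hc : 0 < c)
    (hs : 0 < s) (ht : 0 < t) :
    (a + b) / 2 * Real.log ((a + b) / 2 / (c * ((s + t) / 2))) ≤
      (a * Real.log (a / (c * s)) + b * Real.log (b / (c * t))) / 2 := by
  by_cases h : a / s = b / t
  · have hb' : b = a * t / s := by
      field_simp at h ⊢
      linarith
    have h1 : b / (c * t) = a / (c * s) := by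
      rw [hb']
      field_simp
    have h2 : (a + b) / 2 / (c * ((s + t) / 2)) = a / (c * s) := by
      rw [hb']
      field_simp
    rw [h1, h2]
    exact le_of_eq (by ring)
  · exact (mul_log_half_add_lt ha hb hc hs ht h).le

theorem sub_le_mul_log_div {p q : ℝ} (hp : 0 ≤ p) (hq : 0 ≤ q) (hac : q = 0 → p = 0) :
    p - q ≤ p * Real.log (p / q) := by
  rcases hp.eq_or_lt with rfl | hp'
  · simpa using hq
  · have hq' : 0 < q := hq.lt_of_ne fun h => hp'.ne' (hac h.symm)
    have h := mul_le_mul_of_nonneg_left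
      (Real.one_sub_inv_le_log_of_pos (div_pos hp' hq')) hp
    rwa [inv_div, mul_sub, mul_one, mul_div_cancel₀ _ hp'.ne'] at h

section

variable {X Y : Type*} [Fintype X] [Fintype Y]

theorem IsPMF.sum_margX {P : X × Y → ℝ} (hP : IsPMF P) : ∑ x, margX P x = 1 := by
  rw [← hP.2, Fintype.sum_prod_type]
  rfl

theorem IsPMF.sum_margY {P : X × Y → ℝ} (hP : IsPMF P) : ∑ y, margY P y = 1 := by
  rw [← hP.2, Fintype.sum_prod_type_right]
  rfl

theorem IsPMF.mutualInfo_nonneg {P : X × Y → ℝ} (hP : IsPMF P) : 0 ≤ mutualInfo P := by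
  have hX : ∀ x, 0 ≤ margX P x := fun x => Finset.sum_nonneg fun y _ => hP.1 (x, y)
  have hY : ∀ y, 0 ≤ margY P y := fun y => Finset.sum_nonneg fun x _ => hP.1 (x, y)
  have hterm : ∀ x y, P (x, y) - margX P x * margY P y ≤
      P (x, y) * Real.log (P (x, y) / (margX P x * margY P y)) := by
    intro x y
    refine sub_le_mul_log_div (hP.1 _) (mul_nonneg (hX x) (hY y)) fun h => ?_
    rcases mul_eq_zero.1 h with h | h
    · exact (Finset.sum_eq_zero_iff_of_nonneg fun y _ => hP.1 (x, y)).1 h y (Finset.mem_univ y)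
    · exact (Finset.sum_eq_zero_iff_of_nonneg fun x _ => hP.1 (x, y)).1 h x (Finset.mem_univ x)
  calc (0 : ℝ) = ∑ x, ∑ y, (P (x, y) - margX P x * margY P y) := by
        simp only [Finset.sum_sub_distrib, ← Finset.mul_sum, hP.sum_margY, mul_one,
          hP.sum_margX]
        rw [← Fintype.sum_prod_type, hP.2, sub_self]
    _ ≤ mutualInfo P :=
        Finset.sum_le_sum fun x _ => Finset.sum_le_sum fun y _ => hterm x y

theorem RD_le_mutualInfo {PX : X → ℝ} {d : X → Y → ℝ} {D : ℝ} {P : X × Y → ℝ}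
    (hP : IsPMF P) (hX : margX P = PX) (hd : expDist P d ≤ D) :
    RD PX d D ≤ mutualInfo P :=
  csInf_le ⟨0, by rintro r ⟨R, hR, -, -, rfl⟩; exact hR.mutualInfo_nonneg⟩
    ⟨P, hP, hX, hd, rfl⟩

/-- The equal-weight mixture of two joint distributions. -/
noncomputable def midJoint (P Q : X × Y → ℝ) : X × Y → ℝ :=
  fun p => (P p + Q p) / 2

omit [Fintype X] in
theorem margX_midJoint (P Q : X × Y → ℝ) (x : X) :
    margX (midJoint P Q) x = (margX P x + margX Q x) / 2 := by
  simp only [margX, midJoint, ← Finset.sum_div, Finset.sum_add_distrib]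

omit [Fintype Y] in
theorem margY_midJoint (P Q : X × Y → ℝ) (y : Y) :
    margY (midJoint P Q) y = (margY P y + margY Q y) / 2 := by
  simp only [margY, midJoint, ← Finset.sum_div, Finset.sum_add_distrib]

theorem expDist_midJoint (P Q : X × Y → ℝ) (d : X → Y → ℝ) :
    expDist (midJoint P Q) d = (expDist P d + expDist Q d) / 2 := by
  simp only [expDist, midJoint, div_mul_eq_mul_div, add_mul, ← Finset.sum_div,
    Finset.sum_add_distrib]

theorem IsPMF.midJoint {P Q : X × Y → ℝ} (hP : IsPMF P) (hQ : IsPMF Q) :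
    IsPMF (midJoint P Q) := by
  refine ⟨fun p => div_nonneg (add_nonneg (hP.1 p) (hQ.1 p)) zero_le_two, ?_⟩
  simp only [_root_.midJoint, ← Finset.sum_div, Finset.sum_add_distrib, hP.2, hQ.2]
  norm_num

/-- For a fixed `X`-marginal, mutual information is strictly convex between joint
distributions with different backward channels. -/
theorem mutualInfo_midJoint_lt {P Q : X × Y → ℝ} (hP : ∀ p, 0 ≤ P p) (hQ : ∀ p, 0 ≤ Q p)
    (hX : margX P = margX Q) (hPX : ∀ x, 0 < margX P x)
    (hPY : ∀ y, 0 < margY P y) (hQY : ∀ y, 0 < margY Q y) (hne : condXY P ≠ condXY Q) :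
    mutualInfo (midJoint P Q) < (mutualInfo P + mutualInfo Q) / 2 := by
  obtain ⟨x₀, hx₀⟩ := Function.ne_iff.1 hne
  obtain ⟨y₀, hy₀⟩ := Function.ne_iff.1 hx₀
  have hmX : ∀ x, margX (midJoint P Q) x = margX P x := fun x => by
    rw [margX_midJoint, ← hX, add_self_div_two]
  simp only [mutualInfo, ← Finset.sum_add_distrib, Finset.sum_div, hmX, margY_midJoint, ← hX]
  have hle : ∀ x y, _ := fun x y =>
    mul_log_half_add_le (hP (x, y)) (hQ (x, y)) (hPX x) (hPY y) (hQY y)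
  exact Finset.sum_lt_sum (fun x _ => Finset.sum_le_sum fun y _ => hle x y)
    ⟨x₀, Finset.mem_univ _, Finset.sum_lt_sum (fun y _ => hle x₀ y)
      ⟨y₀, Finset.mem_univ _,
        mul_log_half_add_lt (hP _) (hQ _) (hPX x₀) (hPY y₀) (hQY y₀) hy₀⟩⟩

end

/-- **Lemma 2 (Csiszár–Körner).** Let `D > 0`. If `P` and `Q` both minimize the
rate-distortion function `R(D)` (and their `𝒴`-marginals have full support, so that
the conditional distributions are everywhere defined), then the induced backward
channels coincide: `P_{X|Y} = Q_{X|Y}`. -/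
theorem rd_minimizer_backward_channel_unique
    {X Y : Type*} [Fintype X] [Fintype Y] [Nonempty Y]
    (PX : X → ℝ) (hPX : IsPMF PX) (hPXfull : ∀ x, 0 < PX x)
    (d : X → Y → ℝ) (hd : ∀ x y, 0 ≤ d x y)
    (hdmin : ∑ x, PX x * (Finset.univ.inf' Finset.univ_nonempty fun y => d x y) = 0)
    (D : ℝ) (hD : 0 < D)
    (P Q : X × Y → ℝ)
    (hP : IsRDMinimizer PX d D P) (hQ : IsRDMinimizer PX d D Q)
    (hPY : ∀ y, 0 < margY P y) (hQY : ∀ y, 0 < margY Q y) :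
    condXY P = condXY Q := by
  obtain ⟨hP1, hP2, hP3, hP4⟩ := hP
  obtain ⟨hQ1, hQ2, hQ3, hQ4⟩ := hQ
  by_contra hne
  have hlt := mutualInfo_midJoint_lt hP1.1 hQ1.1 (hP2.trans hQ2.symm)
    (fun x => by rw [hP2]; exact hPXfull x) hPY hQY hne
  have hge : RD PX d D ≤ mutualInfo (midJoint P Q) := by
    refine RD_le_mutualInfo (hP1.midJoint hQ1) ?_ ?_
    · funext x
      rw [margX_midJoint, hP2, hQ2, add_self_div_two]
    · rw [expDist_midJoint]
      linarith
  linarith
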